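/- Let G be the group presented on generators a, b, c, d with relators a², b², c², d², (ab)³, (bc)⁵, (cd)³, (ac)², (ad)², (bd)² and (abc)⁵. Then the relation (bcd)⁵ = 1 also holds in G, and G has order 660. -/

import Mathlib

namespace Stmt12

/-- The generators `a`, `b`, `c`, `d` of the free group on four letters. -/
def a : FreeGroup (Fin 4) := FreeGroup.of 0
def b : FreeGroup (Fin 4) := FreeGroup.of 1
def c : FreeGroup (Fin 4) := FreeGroup.of 2
def d : FreeGroup (Fin 4) := FreeGroup.of 3

/-- Relators for the Coxeter group `[3,5,3]` together with the Petrie relator `(abc)⁵`. -/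
def rels : Set (FreeGroup (Fin 4)) :=
  {a ^ 2, b ^ 2, c ^ 2, d ^ 2, (a * b) ^ 3, (b * c) ^ 5, (c * d) ^ 3,
    (a * c) ^ 2, (a * d) ^ 2, (b * d) ^ 2, (a * b * c) ^ 5}

/-- The group presented by the above relators. -/
abbrev G := PresentedGroup rels

/-- The images of the generators in `G`. -/
def ga : G := PresentedGroup.of 0
def gb : G := PresentedGroup.of 1
def gc : G := PresentedGroup.of 2
def gd : G := PresentedGroup.of 3

open Subgroup

open scoped Pointwise in
/-- If a list of left cosets of `H` contains `H` and is stable under `S`, then `closure S` is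
covered by these cosets, so its order is at most their number times that of `H`. -/
theorem natCard_closure_le {K : Type*} [Group K] {S : Set K} (H : Subgroup K) [Finite H]
    (l : List (K ⧸ H)) (one_mem : ((1 : K) : K ⧸ H) ∈ l) (smul_mem : ∀ s ∈ S, ∀ x ∈ l, s • x ∈ l) :
    Finite (closure S) ∧ Nat.card (closure S) ≤ l.length * Nat.card H := by
  classical
  have hstab : closure S ≤ MulAction.stabilizer K {x | x ∈ l} := by
    rw [closure_le]
    intro s hs
    rw [SetLike.mem_coe, MulAction.mem_stabilizer_set_iff_smul_set_subset l.finite_toSet]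
    exact Set.smul_set_subset_iff.2 fun x hx => smul_mem s hs x hx
  have hsub : (closure S : Set K) ⊆ QuotientGroup.mk ⁻¹' {x : K ⧸ H | x ∈ l} := by
    intro g hg
    have := (MulAction.mem_stabilizer_set.1 (hstab hg) ((1 : K) : K ⧸ H)).2
      (by exact one_mem)
    simpa using this
  have hcard := QuotientGroup.card_preimage_mk H {x : K ⧸ H | x ∈ l}
  have hl : Nat.card {x : K ⧸ H | x ∈ l} ≤ l.length := by
    rw [← List.coe_toFinset, Nat.card_coe_set_eq, Set.ncard_coe_finset]
    exact l.toFinset_card_le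
  have : Finite {x : K ⧸ H | x ∈ l} := l.finite_toSet
  have : Nonempty {x : K ⧸ H | x ∈ l} := ⟨⟨_, one_mem⟩⟩
  have hfin : (QuotientGroup.mk ⁻¹' {x : K ⧸ H | x ∈ l}).Finite :=
    Nat.finite_of_card_ne_zero (hcard ▸ mul_ne_zero Nat.card_pos.ne' Nat.card_pos.ne')
  refine ⟨hfin.subset hsub, (Nat.card_mono hfin hsub).trans ?_⟩
  rw [hcard, mul_comm]
  gcongr

/-- Maps `A`, `B`, `C`, `D` satisfying the defining relations of `G`, in positive braid form. -/
structure PetrieAction {X : Type*} (A B C D : X → X) : Prop where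
  aa : ∀ x, A (A x) = x
  bb : ∀ x, B (B x) = x
  cc : ∀ x, C (C x) = x
  dd : ∀ x, D (D x) = x
  ac : ∀ x, A (C x) = C (A x)
  ad : ∀ x, A (D x) = D (A x)
  bd : ∀ x, B (D x) = D (B x)
  aba : ∀ x, A (B (A x)) = B (A (B x))
  cdc : ∀ x, C (D (C x)) = D (C (D x))
  bcbcb : ∀ x, B (C (B (C (B x)))) = C (B (C (B (C x))))
  petrie : ∀ x, A (B (C (A (B (C (A (B (C (A (B (C (A (B (C x)))))))))))))) = x

namespace PetrieAction

variable {X : Type*} {A B C D : X → X} {x : X}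

/-- The images of a point fixed by `B` under the group generated by `B` and `C`. -/
theorem orbit_bc (h : PetrieAction A B C D) (hb : B x = x) :
    ∀ F ∈ [B, C], ∀ y ∈ [x, C x, B (C x), C (B (C x)), B (C (B (C x)))],
      F y ∈ [x, C x, B (C x), C (B (C x)), B (C (B (C x)))] := by
  have h₁ : C (B (C (B (C x)))) = B (C (B (C x))) := by
    rw [← h.bcbcb, hb]
  simp [hb, h₁, h.bb, h.cc]

/-- The images of a point fixed by `B` and `C` under the group generated by `A`, `B` and `C`. -/
theorem orbit_abc (h : PetrieAction A B C D) (hb : B x = x) (hc : C x = x) :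
    ∀ F ∈ [A, B, C],
      ∀ y ∈ [x, A x, B (A x), C (B (A x)), B (C (B (A x))), A (B (C (B (A x))))],
        F y ∈ [x, A x, B (A x), C (B (A x)), B (C (B (A x))), A (B (C (B (A x))))] := by
  obtain ⟨aa, bb, cc, -, ac, -, -, aba, -, bcbcb, petrie⟩ := h
  have h₁ : C (A x) = A x := by grind
  have h₂ : A (B (A x)) = B (A x) := by grind
  have h₃ : A (C (B (A x))) = C (B (A x)) := by grind
  have h₄ : C (B (C (B (A x)))) = A (B (C (B (A x)))) := by grind
  have h₅ : C (A (B (C (B (A x))))) = B (C (B (A x))) := by grind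
  have h₆ : B (A (B (C (B (A x))))) = A (B (C (B (A x)))) := by grind
  simp [hb, hc, h₁, h₂, h₃, h₄, h₅, h₆, aa, bb, cc]

/-- The collapse of the coset graph: the relation between cosets of the facet subgroup from which
the enumeration closes up. -/
theorem collapse (h : PetrieAction A B C D) (ha : A x = x) (hb : B x = x) (hc : C x = x) :
    D (C (B (C (D x)))) = B (C (B (C (D x)))) := by
  obtain ⟨aa, bb, cc, dd, ac, ad, bd, aba, cdc, bcbcb, petrie⟩ := h
  have := cdc x
  have := bcbcb (D x)
  have := aba (B (C (D x)))
  have := cdc (D (C (B (C (D x)))))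
  have := aba (A (B (C (B (C (D x))))))
  have := petrie (A (B (C (B (C (D x))))))
  have := cdc (A (B (C (B (C (D x))))))
  have := petrie (D (C (A (B (C (D x))))))
  have := aba (D (B (C (A (B (C (D x)))))))
  have := cdc (B (A (B (C (B (C (D x)))))))
  have := cdc (B (C (D (A (B (C (B (C (D x)))))))))
  have := bcbcb (B (C (D (B (C (A (B (C (D x)))))))))
  have := aba (D (C (B (C (D (B (A (B (C (B (C (D x))))))))))))
  have := cdc (D (C (B (C (D (B (A (B (C (B (C (D x))))))))))))
  have := bcbcb (B (C (B (C (D (B (A (B (C (B (C (D x))))))))))))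
  have := petrie (D (C (B (C (D (B (A (B (C (B (C (D x))))))))))))
  have := cdc (C (A (B (D (C (B (C (D (A (B (C (B (C (D x))))))))))))))
  clear petrie bcbcb cdc aba
  grind

/-- The images of a point fixed by `A`, `B` and `C` under the group generated by `A`, `B`, `C`
and `D`. -/
theorem orbit_abcd (h : PetrieAction A B C D) (ha : A x = x) (hb : B x = x) (hc : C x = x)
    {l : List X}
    (hl : l = [x, D x, C (D x), B (C (D x)), A (B (C (D x))), C (B (C (D x))),
      B (C (B (C (D x)))), A (C (B (C (D x)))), A (B (C (B (C (D x))))),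
      B (A (C (B (C (D x))))), B (A (B (C (B (C (D x))))))]) :
    ∀ F ∈ [A, B, C, D], ∀ y ∈ l, F y ∈ l := by
  have d₅ := h.collapse ha hb hc
  obtain ⟨aa, bb, cc, dd, ac, ad, bd, aba, cdc, bcbcb, petrie⟩ := h
  have a₁ : A (D x) = D x := by grind
  have a₂ : A (C (D x)) = C (D x) := by grind
  have b₁ : B (D x) = D x := by grind
  have d₂ : D (C (D x)) = C (D x) := by grind
  have d₃ : D (B (C (D x))) = B (C (D x)) := by grind
  have b₄ : B (A (B (C (D x)))) = A (B (C (D x))) := by grind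
  have c₄ : C (A (B (C (D x)))) = A (C (B (C (D x)))) := by grind
  have c₇ : C (A (C (B (C (D x))))) = A (B (C (D x))) := by grind
  have d₄ : D (A (B (C (D x)))) = A (B (C (D x))) := by grind
  have d₆ : D (B (C (B (C (D x))))) = C (B (C (D x))) := by grind
  have c₆ : C (B (C (B (C (D x))))) = B (C (B (C (D x)))) := by grind
  have d₇ : D (A (C (B (C (D x))))) = A (B (C (B (C (D x))))) := by grind
  have d₈ : D (A (B (C (B (C (D x)))))) = A (C (B (C (D x)))) := by grind
  have c₈ : C (A (B (C (B (C (D x)))))) = A (B (C (B (C (D x))))) := by grind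
  have d₉ : D (B (A (C (B (C (D x)))))) = B (A (B (C (B (C (D x)))))) := by grind
  have d₁₀ : D (B (A (B (C (B (C (D x))))))) = B (A (C (B (C (D x))))) := by grind
  have a₉ : A (B (A (C (B (C (D x)))))) = B (A (B (C (B (C (D x)))))) := by grind
  have a₁₀ : A (B (A (B (C (B (C (D x))))))) = B (A (C (B (C (D x))))) := by grind
  have c₉ : C (B (A (C (B (C (D x)))))) = B (A (B (C (B (C (D x)))))) := by grind
  have c₁₀ : C (B (A (B (C (B (C (D x))))))) = B (A (C (B (C (D x))))) := by grind
  subst hl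
  simp [ha, hb, hc, a₁, a₂, b₁, b₄, c₄, c₆, c₇, c₈, d₂, d₃, d₄, d₅, d₆, d₇, d₈, d₉, d₁₀, a₉, a₁₀,
    c₉, c₁₀, aa, bb, cc, dd]

end PetrieAction

theorem mul_mul_eq_of_pow_three {M : Type*} [Group M] {x y : M} (hx : x * x = 1) (hy : y * y = 1)
    (h : (x * y) ^ 3 = 1) : x * (y * x) = y * (x * y) := by
  have hx' : x⁻¹ = x := inv_eq_of_mul_eq_one_left hx
  have hy' : y⁻¹ = y := inv_eq_of_mul_eq_one_left hy
  have : (x * (y * x)) * (y * (x * y)) = 1 := by simpa [pow_succ, mul_assoc] using h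
  simpa [hx', hy', mul_assoc] using eq_inv_of_mul_eq_one_left this

theorem mul_comm_of_pow_two {M : Type*} [Group M] {x y : M} (hx : x * x = 1) (hy : y * y = 1)
    (h : (x * y) ^ 2 = 1) : x * y = y * x := by
  have hx' : x⁻¹ = x := inv_eq_of_mul_eq_one_left hx
  have hy' : y⁻¹ = y := inv_eq_of_mul_eq_one_left hy
  have : (x * y) * (x * y) = 1 := by simpa [pow_succ] using h
  simpa [hx', hy'] using eq_inv_of_mul_eq_one_left this

theorem mul_mul_eq_of_pow_five {M : Type*} [Group M] {x y : M} (hx : x * x = 1) (hy : y * y = 1)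
    (h : (x * y) ^ 5 = 1) : x * (y * (x * (y * x))) = y * (x * (y * (x * y))) := by
  have hx' : x⁻¹ = x := inv_eq_of_mul_eq_one_left hx
  have hy' : y⁻¹ = y := inv_eq_of_mul_eq_one_left hy
  have : (x * (y * (x * (y * x)))) * (y * (x * (y * (x * y)))) = 1 := by
    simpa [pow_succ, mul_assoc] using h
  simpa [hx', hy', mul_assoc] using eq_inv_of_mul_eq_one_left this

/-- The generators of `G` act on any `G`-set by maps satisfying the relations. -/
theorem petrieAction {X : Type*} [MulAction G X] :
    PetrieAction (X := X) (ga • ·) (gb • ·) (gc • ·) (gd • ·) := by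
  have hrel {r : FreeGroup (Fin 4)} (hr : r ∈ rels) : PresentedGroup.mk rels r = 1 :=
    PresentedGroup.one_of_mem hr
  have aa : ga * ga = 1 := (pow_two ga).symm.trans (hrel (r := a ^ 2) (by simp [rels]))
  have bb : gb * gb = 1 := (pow_two gb).symm.trans (hrel (r := b ^ 2) (by simp [rels]))
  have cc : gc * gc = 1 := (pow_two gc).symm.trans (hrel (r := c ^ 2) (by simp [rels]))
  have dd : gd * gd = 1 := (pow_two gd).symm.trans (hrel (r := d ^ 2) (by simp [rels]))
  have ab : (ga * gb) ^ 3 = 1 := hrel (r := (a * b) ^ 3) (by simp [rels])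
  have bc : (gb * gc) ^ 5 = 1 := hrel (r := (b * c) ^ 5) (by simp [rels])
  have cd : (gc * gd) ^ 3 = 1 := hrel (r := (c * d) ^ 3) (by simp [rels])
  have ac : (ga * gc) ^ 2 = 1 := hrel (r := (a * c) ^ 2) (by simp [rels])
  have ad : (ga * gd) ^ 2 = 1 := hrel (r := (a * d) ^ 2) (by simp [rels])
  have bd : (gb * gd) ^ 2 = 1 := hrel (r := (b * d) ^ 2) (by simp [rels])
  have abc : (ga * gb * gc) ^ 5 = 1 := hrel (r := (a * b * c) ^ 5) (by simp [rels])
  constructor <;> intro x <;> simp only [smul_smul]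
  · rw [aa, one_smul]
  · rw [bb, one_smul]
  · rw [cc, one_smul]
  · rw [dd, one_smul]
  · rw [mul_comm_of_pow_two aa cc ac]
  · rw [mul_comm_of_pow_two aa dd ad]
  · rw [mul_comm_of_pow_two bb dd bd]
  · simp only [mul_mul_eq_of_pow_three aa bb ab]
  · simp only [mul_mul_eq_of_pow_three cc dd cd]
  · simp only [mul_mul_eq_of_pow_five bb cc bc]
  · simp only [pow_succ, pow_zero, one_mul, mul_assoc] at abc ⊢
    rw [abc, one_smul]

theorem smul_mk_one {K : Type*} [Group K] {H : Subgroup K} {g : K} (hg : g ∈ H) :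
    g • ((1 : K) : K ⧸ H) = ((1 : K) : K ⧸ H) := by
  rw [MulAction.Quotient.smul_mk, QuotientGroup.eq]
  simpa using hg

theorem closure_generators : Subgroup.closure ({ga, gb, gc, gd} : Set G) = ⊤ := by
  rw [← PresentedGroup.closure_range_of rels]
  congr 1
  ext g
  simp [Fin.exists_fin_succ, ga, gb, gc, gd, eq_comm]

theorem finite_and_natCard_le : Finite G ∧ Nat.card G ≤ 660 := by
  have hb : gb ^ 2 = 1 := by simpa [pow_two] using petrieAction.bb (1 : G)
  have : Finite (zpowers gb) :=
    (isOfFinOrder_iff_pow_eq_one.2 ⟨2, two_pos, hb⟩).finite_zpowers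
  have h₂ : Nat.card (zpowers gb) ≤ 2 := by
    rw [Nat.card_zpowers]
    exact orderOf_le_of_pow_eq_one two_pos hb
  have fixed {S : Set G} {g : G} (hg : g ∈ S) :
      g • ((1 : G) : G ⧸ Subgroup.closure S) = ((1 : G) : G ⧸ Subgroup.closure S) :=
    smul_mk_one (subset_closure hg)
  have orbit₅ := petrieAction.orbit_bc (smul_mk_one (mem_zpowers gb))
  obtain ⟨_, h₁₀⟩ := natCard_closure_le (S := {gb, gc}) _ _ List.mem_cons_self
    fun s hs => orbit₅ (s • ·) (by rcases hs with rfl | rfl <;> simp)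
  have orbit₆ := petrieAction.orbit_abc (fixed (S := {gb, gc}) (g := gb) (by simp))
    (fixed (g := gc) (by simp))
  obtain ⟨_, h₆₀⟩ := natCard_closure_le (S := {ga, gb, gc}) _ _ List.mem_cons_self
    fun s hs => orbit₆ (s • ·) (by rcases hs with rfl | rfl | rfl <;> simp)
  have orbit₁₁ := petrieAction.orbit_abcd (fixed (S := {ga, gb, gc}) (g := ga) (by simp))
    (fixed (g := gb) (by simp)) (fixed (g := gc) (by simp)) rfl
  obtain ⟨hfin, h₆₆₀⟩ := natCard_closure_le (S := {ga, gb, gc, gd}) _ _ List.mem_cons_self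
    fun s hs => orbit₁₁ (s • ·) (by rcases hs with rfl | rfl | rfl | rfl <;> simp)
  rw [closure_generators] at hfin h₆₆₀
  simp only [List.length_cons, List.length_nil, card_top] at h₁₀ h₆₀ h₆₆₀
  exact ⟨(Equiv.finite_iff topEquiv.toEquiv).1 hfin, by lia⟩

/-- The action of the generators of `G` on the eleven facets of the 11-cell. -/
def facetPerm : Fin 4 → Equiv.Perm (Fin 11) :=
  ![Function.Involutive.toPerm ![0, 1, 2, 4, 3, 7, 8, 5, 6, 10, 9] <|
      by unfold Function.Involutive; decide,
    Function.Involutive.toPerm ![0, 1, 3, 2, 4, 6, 5, 9, 10, 7, 8] <|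
      by unfold Function.Involutive; decide,
    Function.Involutive.toPerm ![0, 2, 1, 5, 7, 3, 6, 4, 8, 10, 9] <|
      by unfold Function.Involutive; decide,
    Function.Involutive.toPerm ![1, 0, 2, 3, 4, 6, 5, 8, 7, 10, 9] <|
      by unfold Function.Involutive; decide]

theorem lift_facetPerm_eq_one : ∀ r ∈ rels, FreeGroup.lift facetPerm r = 1 := by
  simp only [rels, Set.mem_insert_iff, Set.mem_singleton_iff, forall_eq_or_imp, forall_eq,
    a, b, c, d, map_mul, map_pow, FreeGroup.lift_apply_of]
  decide +kernel

/-- The action of `G` on the eleven facets of the 11-cell. -/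
def facetHom : G →* Equiv.Perm (Fin 11) :=
  PresentedGroup.toGroup lift_facetPerm_eq_one

theorem facetHom_of (i : Fin 4) : facetHom (PresentedGroup.of i) = facetPerm i := by
  rw [facetHom, PresentedGroup.toGroup.of]

theorem four_dvd_natCard {K : Type*} [Group K] {x y : K} (hx : x * x = 1) (hy : y * y = 1)
    (hxy : x * y = y * x) (hx1 : x ≠ 1) (hy1 : y ≠ 1) (hne : x ≠ y) : 4 ∣ Nat.card K := by
  have hx' : x⁻¹ = x := inv_eq_of_mul_eq_one_left hx
  have hy' : y⁻¹ = y := inv_eq_of_mul_eq_one_left hy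
  have hx₂ (z : K) : x * (x * z) = z := by rw [← mul_assoc, hx, one_mul]
  have hyxy : y * (x * y) = x := by rw [hxy, ← mul_assoc, hy, one_mul]
  let V : Subgroup K :=
    { carrier := {1, x, y, x * y}
      one_mem' := by simp
      mul_mem' := by
        rintro _ _ (rfl | rfl | rfl | rfl) (rfl | rfl | rfl | rfl) <;>
          simp [mul_assoc, hx, hy, ← hxy, hx₂, hyxy]
      inv_mem' := by
        rintro _ (rfl | rfl | rfl | rfl) <;> simp [hx', hy', hxy] }
  have hV : Nat.card V = 4 := by
    classical
    have : (V : Set K) = ({1, x, y, x * y} : Finset K) := by simp [V]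
    rw [← SetLike.coe_sort_coe, this, Nat.card_coe_set_eq, Set.ncard_coe_finset]
    have hxy1 : 1 ≠ x * y := fun h => hne (by rw [← hx', inv_eq_of_mul_eq_one_right h.symm])
    simp [hx1.symm, hy1.symm, hne, hxy1, hx1, hy1]
  exact hV ▸ V.card_subgroup_dvd_card

theorem dvd_natCard_range : 660 ∣ Nat.card facetHom.range := by
  have mem (i : Fin 4) : facetPerm i ∈ facetHom.range := ⟨_, facetHom_of i⟩
  have prime_dvd (p : ℕ) [Fact p.Prime] {σ : Equiv.Perm (Fin 11)} (hσ : σ ∈ facetHom.range)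
      (hp : σ ^ p = 1) (h1 : σ ≠ 1) : p ∣ Nat.card facetHom.range :=
    orderOf_eq_prime hp h1 ▸ Subgroup.orderOf_dvd_natCard _ hσ
  have h3 := prime_dvd 3 (mul_mem (mem 0) (mem 1)) (by decide +kernel) (by decide +kernel)
  have : Fact (Nat.Prime 5) := ⟨by norm_num⟩
  have h5 := prime_dvd 5 (mul_mem (mem 1) (mem 2)) (by decide +kernel) (by decide +kernel)
  have : Fact (Nat.Prime 11) := ⟨by norm_num⟩
  have h11 := prime_dvd 11
    (mul_mem (mul_mem (mul_mem (mul_mem (mem 0) (mem 1)) (mem 2)) (mul_mem (mem 1) (mem 2))) (mem 3))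
    (by decide +kernel) (by decide +kernel)
  have h4 : 4 ∣ Nat.card facetHom.range := by
    apply four_dvd_natCard (x := ⟨facetPerm 0, mem 0⟩) (y := ⟨facetPerm 2, mem 2⟩) <;>
      simp only [ne_eq, MulMemClass.mk_mul_mk, Subtype.mk.injEq, mk_eq_one] <;> decide +kernel
  lia

/-- In the group presented on `a, b, c, d` with relators `a², b², c², d², (ab)³, (bc)⁵,
`(cd)³, (ac)², (ad)², (bd)²` and `(abc)⁵`, the relation `(bcd)⁵ = 1` also holds, and
the group has order 660. -/
theorem statement_12 : (gb * gc * gd) ^ 5 = 1 ∧ Nat.card G = 660 := by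
  obtain ⟨_, hle⟩ := finite_and_natCard_le
  have hrange : Nat.card facetHom.range = Nat.card G :=
    le_antisymm (Nat.le_of_dvd Nat.card_pos (card_range_dvd facetHom))
      (hle.trans (Nat.le_of_dvd Nat.card_pos dvd_natCard_range))
  have hcard : Nat.card G = 660 :=
    hle.antisymm (Nat.le_of_dvd Nat.card_pos (hrange ▸ dvd_natCard_range))
  have hinj : Function.Injective facetHom := by
    rw [← MonoidHom.rangeRestrict_injective_iff]
    exact ((Nat.bijective_iff_surjective_and_card _).2
      ⟨facetHom.rangeRestrict_surjective, hrange.symm⟩).1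
  refine ⟨hinj ?_, hcard⟩
  simp only [gb, gc, gd, map_pow, map_mul, map_one, facetHom_of]
  decide +kernel

end Stmt12
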